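/- arXiv:math/9908141 — 2 statements merged into one kernel-verified Lean document; each statement's English description precedes it below -/
import Mathlib

section
/- For every real α > −1 and every real x, the series Σ_{i=1}^∞ a_i(α,x) converges and Σ_{i=1}^∞ a_i(α,x) = −(sin(πα)/π) · (x/((α+2)(α+3))) · ₁F₁(1; α+4; −x). -/
open Finset

/-- Generalized binomial coefficient `C(z, k)` for real `z` and integer `k`,
equal to `z (z-1) ⋯ (z-k+1) / k!` for `k ≥ 0` and `0` for `k < 0`. -/
noncomputable def gbinom (z : ℝ) (k : ℤ) : ℝ :=
  if 0 ≤ k then (∏ j ∈ Finset.range k.toNat, (z - (j : ℝ))) / (Nat.factorial k.toNat : ℝ)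
  else 0

/-- Pochhammer symbol `(z)_k = z (z+1) ⋯ (z+k-1)`. -/
noncomputable def poch (z : ℝ) (k : ℕ) : ℝ :=
  ∏ j ∈ Finset.range k, (z + (j : ℝ))

/-- Classical Laguerre polynomial `L_n^α(x) = ∑_{k=0}^n (-1)^k C(n+α, n-k) x^k / k!`. -/
noncomputable def laguerre (α : ℝ) (n : ℕ) (x : ℝ) : ℝ :=
  ∑ k ∈ Finset.range (n + 1),
    (-1 : ℝ) ^ k * gbinom ((n : ℝ) + α) ((n : ℤ) - (k : ℤ)) * x ^ k / (Nat.factorial k : ℝ)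

/-- The coefficient functions `a_i(α, x)` for `i ≥ 1`. -/
noncomputable def aFun (α : ℝ) (i : ℕ) (x : ℝ) : ℝ :=
  (1 / (Nat.factorial i : ℝ)) * ∑ j ∈ Finset.Icc 1 i,
    (-1 : ℝ) ^ (i + j + 1) * gbinom (α + 1) ((j : ℤ) - 1) *
      gbinom (α + 2) ((i : ℤ) - (j : ℤ)) * poch (α + 3) (i - j) * x ^ j

open Filter Topology

lemma poch_zero (z : ℝ) : poch z 0 = 1 := by simp [poch]

lemma poch_succ (z : ℝ) (k : ℕ) : poch z (k + 1) = poch z k * (z + k) := by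
  simp [poch, Finset.prod_range_succ]

lemma poch_pos {z : ℝ} (hz : 0 < z) (k : ℕ) : 0 < poch z k :=
  Finset.prod_pos fun _ _ => by positivity

lemma poch_one (k : ℕ) : poch 1 k = (Nat.factorial k : ℝ) := by
  induction k with
  | zero => simp [poch_zero]
  | succ k ih => rw [poch_succ, ih, Nat.factorial_succ]; push_cast; ring

lemma gbinom_zero (z : ℝ) : gbinom z ((0 : ℕ) : ℤ) = 1 := by simp [gbinom]

lemma gbinom_succ (z : ℝ) (k : ℕ) :
    gbinom z ((k + 1 : ℕ) : ℤ) = gbinom z (k : ℤ) * (z - k) / (k + 1) := by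
  have h : (Nat.factorial k : ℝ) ≠ 0 := by positivity
  simp only [gbinom, Int.natCast_nonneg, if_true, Int.toNat_natCast, Finset.prod_range_succ,
    Nat.factorial_succ]
  push_cast
  field_simp

/-- The numerator `(-β)_r (β+1)_r / r!` of a Gauss series whose upper parameters sum to `1`. -/
noncomputable def gaussNum (β : ℝ) (r : ℕ) : ℝ :=
  (-1) ^ r * gbinom β (r : ℤ) * poch (β + 1) r

lemma gaussNum_zero (β : ℝ) : gaussNum β 0 = 1 := by
  simp only [gaussNum, gbinom_zero, poch_zero]; norm_num

lemma gaussNum_succ (β : ℝ) (r : ℕ) :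
    gaussNum β (r + 1) = gaussNum β r * ((r - β) * (r + β + 1)) / (r + 1) := by
  simp only [gaussNum, gbinom_succ, poch_succ, pow_succ]
  ring

/-- The term `(-β)_r (β+1)_r / (r! (m+r+1)!)`. -/
noncomputable def gaussTerm (β : ℝ) (m r : ℕ) : ℝ :=
  gaussNum β r / (Nat.factorial (m + r + 1) : ℝ)

lemma gaussTerm_succ_right (β : ℝ) (m r : ℕ) :
    gaussTerm β m (r + 1) =
      gaussTerm β m r * ((r - β) * (r + β + 1)) / ((r + 1) * (m + r + 2)) := by
  have h : (Nat.factorial (m + r + 1) : ℝ) ≠ 0 := by positivity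
  have h1 : (r : ℝ) + 1 ≠ 0 := by positivity
  have h2 : (m : ℝ) + r + 2 ≠ 0 := by positivity
  have h3 : (m : ℝ) + r + 1 + 1 ≠ 0 := by positivity
  rw [gaussTerm, gaussTerm, gaussNum_succ, show m + (r + 1) + 1 = (m + r + 1) + 1 by ring,
    Nat.factorial_succ (m + r + 1)]
  push_cast
  field_simp
  ring

lemma gaussTerm_succ_left (β : ℝ) (m r : ℕ) :
    gaussTerm β (m + 1) r = gaussTerm β m r / (m + r + 2) := by
  have h : (Nat.factorial (m + r + 1) : ℝ) ≠ 0 := by positivity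
  have h2 : (m : ℝ) + r + 2 ≠ 0 := by positivity
  have h3 : (m : ℝ) + r + 1 + 1 ≠ 0 := by positivity
  rw [gaussTerm, gaussTerm, show m + 1 + r + 1 = (m + r + 1) + 1 by ring,
    Nat.factorial_succ (m + r + 1)]
  push_cast
  field_simp
  ring

/-- The closed form of the partial sums of `gaussTerm β 0`. -/
noncomputable def gaussPartial (β : ℝ) (n : ℕ) : ℝ :=
  (∏ j ∈ Finset.range n, (1 - β ^ 2 / ((j : ℝ) + 1) ^ 2)) * ((1 + β + n) / ((1 + β) * (n + 1)))

lemma gaussPartial_zero {β : ℝ} (hβ : 1 + β ≠ 0) : gaussPartial β 0 = 1 := by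
  simp [gaussPartial, hβ]

lemma gaussPartial_succ {β : ℝ} (hβ : 0 < β) (n : ℕ) :
    gaussPartial β (n + 1) =
      gaussPartial β n * ((n + 1 - β) * (n + 2 + β)) / ((n + 1) * (n + 2)) := by
  have h1 : (n : ℝ) + 1 ≠ 0 := by positivity
  have h2 : (n : ℝ) + 2 ≠ 0 := by positivity
  have h3 : (n : ℝ) + 1 + 1 ≠ 0 := by positivity
  have h4 : 1 + β ≠ 0 := by positivity
  simp only [gaussPartial, Finset.prod_range_succ]
  push_cast
  field_simp
  ring

lemma gaussTerm_zero_succ {β : ℝ} (hβ : 0 < β) (n : ℕ) :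
    gaussTerm β 0 (n + 1) = -(β * (β + 1)) * gaussPartial β n / ((n + 1) * (n + 2)) := by
  induction n with
  | zero =>
    rw [gaussTerm_succ_right, gaussPartial_zero (by positivity), gaussTerm, gaussNum_zero]
    norm_num
  | succ n ih =>
    have h1 : (n : ℝ) + 1 ≠ 0 := by positivity
    have h2 : (n : ℝ) + 2 ≠ 0 := by positivity
    have h3 : (n : ℝ) + 1 + 1 ≠ 0 := by positivity
    have h4 : (n : ℝ) + 1 + 2 ≠ 0 := by positivity
    rw [gaussTerm_succ_right, ih, gaussPartial_succ hβ]
    push_cast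
    rw [show (0 : ℝ) + (n + 1) + 2 = n + 1 + 2 by ring]
    field_simp
    ring

lemma sum_gaussTerm_zero {β : ℝ} (hβ : 0 < β) (n : ℕ) :
    ∑ r ∈ Finset.range (n + 1), gaussTerm β 0 r = gaussPartial β n := by
  induction n with
  | zero => simp [gaussPartial_zero (show 1 + β ≠ 0 by positivity), gaussTerm, gaussNum_zero]
  | succ n ih =>
    have h1 : (n : ℝ) + 1 ≠ 0 := by positivity
    have h2 : (n : ℝ) + 2 ≠ 0 := by positivity
    rw [Finset.sum_range_succ, ih, gaussTerm_zero_succ hβ, gaussPartial_succ hβ]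
    field_simp
    ring

lemma tendsto_gaussPartial {β : ℝ} (hβ : 0 < β) :
    Tendsto (gaussPartial β) atTop
      (𝓝 (Real.sin (Real.pi * β) / (Real.pi * β * (1 + β)))) := by
  have hpi := Real.pi_pos
  have h4 : 1 + β ≠ 0 := by positivity
  have hlim : Tendsto (fun n : ℕ => (1 + β * (1 / ((n : ℝ) + 1))) / (1 + β)) atTop
      (𝓝 ((1 + β * 0) / (1 + β))) :=
    ((tendsto_one_div_add_atTop_nhds_zero_nat.const_mul β).const_add 1).div_const _
  have h := ((Real.tendsto_euler_sin_prod β).div_const (Real.pi * β)).mul hlim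
  convert h using 1
  · ext n
    have h1 : (n : ℝ) + 1 ≠ 0 := by positivity
    simp only [gaussPartial]
    field_simp
    ring
  · congr 1
    field_simp
    ring

lemma exists_gaussTerm_bound {β : ℝ} (hβ : 0 < β) :
    ∃ C : ℝ, ∀ n : ℕ, |gaussTerm β 0 (n + 1)| ≤ C * (1 / ((n : ℝ) + 1) ^ 2) := by
  obtain ⟨C, hC⟩ := (tendsto_gaussPartial hβ).abs.bddAbove_range
  refine ⟨β * (β + 1) * C, fun n => ?_⟩
  have hn : |gaussPartial β n| ≤ C := hC ⟨n, rfl⟩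
  have hC0 : 0 ≤ C := (abs_nonneg _).trans hn
  rw [gaussTerm_zero_succ hβ, abs_div, abs_mul, abs_neg,
    abs_of_pos (show 0 < β * (β + 1) by positivity),
    abs_of_pos (show (0 : ℝ) < (n + 1) * (n + 2) by positivity), mul_one_div]
  gcongr
  nlinarith [show (0 : ℝ) ≤ n by positivity]

lemma summable_abs_gaussTerm_zero {β : ℝ} (hβ : 0 < β) :
    Summable fun r => |gaussTerm β 0 r| := by
  obtain ⟨C, hC⟩ := exists_gaussTerm_bound hβ
  refine (summable_nat_add_iff 1).mp ?_
  refine Summable.of_nonneg_of_le (fun _ => abs_nonneg _) hC (Summable.mul_left _ ?_)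
  simpa using (summable_nat_add_iff 1).mpr (Real.summable_one_div_nat_pow.mpr one_lt_two)

lemma abs_gaussTerm_le (β : ℝ) (m r : ℕ) :
    |gaussTerm β m r| ≤ |gaussTerm β 0 r| / (Nat.factorial m : ℝ) := by
  have h : (Nat.factorial (0 + r + 1) * Nat.factorial m : ℝ) ≤ Nat.factorial (m + r + 1) := by
    rw [show m + r + 1 = (0 + r + 1) + m by ring]
    exact_mod_cast Nat.le_of_dvd (Nat.factorial_pos _) (Nat.factorial_mul_factorial_dvd_factorial_add _ _)
  simp only [gaussTerm, abs_div, Nat.abs_cast, div_div]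
  gcongr

lemma summable_gaussTerm {β : ℝ} (hβ : 0 < β) (m : ℕ) : Summable (gaussTerm β m) :=
  Summable.of_abs <| Summable.of_nonneg_of_le (fun _ => abs_nonneg _) (abs_gaussTerm_le β m)
    ((summable_abs_gaussTerm_zero hβ).div_const _)

lemma tsum_gaussTerm_zero {β : ℝ} (hβ : 0 < β) :
    ∑' r, gaussTerm β 0 r = Real.sin (Real.pi * β) / (Real.pi * β * (1 + β)) := by
  refine tendsto_nhds_unique
    ((tendsto_add_atTop_iff_nat 1).mpr (summable_gaussTerm hβ 0).hasSum.tendsto_sum_nat) ?_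
  simpa only [sum_gaussTerm_zero hβ] using tendsto_gaussPartial hβ

lemma tendsto_mul_gaussTerm {β : ℝ} (hβ : 0 < β) (m : ℕ) :
    Tendsto (fun r : ℕ => (r : ℝ) * gaussTerm β m r) atTop (𝓝 0) := by
  obtain ⟨C, hC⟩ := exists_gaussTerm_bound hβ
  refine (tendsto_add_atTop_iff_nat 1).mp ?_
  have hlim : Tendsto (fun n : ℕ => C * (1 / ((n : ℝ) + 1))) atTop (𝓝 0) := by
    simpa using tendsto_one_div_add_atTop_nhds_zero_nat.const_mul C
  refine squeeze_zero_norm (fun n => ?_) hlim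
  have hm : (1 : ℝ) ≤ Nat.factorial m := by exact_mod_cast Nat.factorial_pos m
  have h := ((abs_gaussTerm_le β m (n + 1)).trans (div_le_self (abs_nonneg _) hm)).trans (hC n)
  have h1 : (0 : ℝ) < n + 1 := by positivity
  rw [Real.norm_eq_abs, abs_mul, Nat.abs_cast]
  push_cast
  calc ((n : ℝ) + 1) * |gaussTerm β m (n + 1)| ≤ (n + 1) * (C * (1 / ((n : ℝ) + 1) ^ 2)) := by gcongr
    _ = C * (1 / ((n : ℝ) + 1)) := by field_simp

/-- The contiguous relation in the lower parameter. -/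
lemma tsum_gaussTerm_succ {β : ℝ} (hβ : 0 < β) (m : ℕ) :
    (m + 1) * ∑' r, gaussTerm β m r =
      (m + 1 - β) * (m + 2 + β) * ∑' r, gaussTerm β (m + 1) r := by
  have hs := ((summable_gaussTerm hβ m).hasSum.mul_left ((m : ℝ) + 1)).sub
    ((summable_gaussTerm hβ (m + 1)).hasSum.mul_left ((m + 1 - β) * (m + 2 + β)))
  have key : ∀ n, ∑ r ∈ Finset.range n, (((m : ℝ) + 1) * gaussTerm β m r -
      (m + 1 - β) * (m + 2 + β) * gaussTerm β (m + 1) r) = -(n * gaussTerm β m n) := by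
    intro n
    induction n with
    | zero => simp
    | succ n ih =>
      have h1 : (n : ℝ) + 1 ≠ 0 := by positivity
      have h2 : (m : ℝ) + n + 2 ≠ 0 := by positivity
      rw [Finset.sum_range_succ, ih, gaussTerm_succ_left, gaussTerm_succ_right]
      push_cast
      field_simp
      ring
  have h0 := hs.tendsto_sum_nat
  simp only [key] at h0
  have := tendsto_nhds_unique h0 (tendsto_mul_gaussTerm hβ m).neg
  linarith

lemma gbinom_mul_tsum_gaussTerm {α : ℝ} (hα : -1 < α) (m : ℕ) :
    gbinom (α + 1) (m : ℤ) * ∑' r, gaussTerm (α + 2) m r =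
      (-1) ^ m * (Real.sin (Real.pi * α) / Real.pi) /
        ((α + 2) * (α + 3) * poch (α + 4) m) := by
  have hβ : 0 < α + 2 := by linarith
  have h3 : α + 3 ≠ 0 := by linarith
  induction m with
  | zero =>
    rw [gbinom_zero, tsum_gaussTerm_zero hβ, poch_zero,
      show Real.pi * (α + 2) = Real.pi * α + 2 * Real.pi by ring, Real.sin_add_two_pi,
      show Real.pi * α + 2 * Real.pi = Real.pi * (α + 2) by ring,
      show 1 + (α + 2) = α + 3 by ring]
    have := Real.pi_ne_zero
    field_simp
  | succ m ih =>
    have hp := (poch_pos (show 0 < α + 4 by linarith) m).ne'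
    have h4 : α + 4 + m ≠ 0 := by
      have : (0 : ℝ) ≤ m := by positivity
      linarith
    have h1 : (m : ℝ) + 1 ≠ 0 := by positivity
    have hrec := tsum_gaussTerm_succ hβ m
    rw [gbinom_succ, poch_succ]
    have hstep : gbinom (α + 1) (m : ℤ) * (α + 1 - m) / (m + 1) *
        ∑' r, gaussTerm (α + 2) (m + 1) r =
        -(gbinom (α + 1) (m : ℤ) * ∑' r, gaussTerm (α + 2) m r) / (α + 4 + m) := by
      rw [eq_div_iff h4]
      field_simp
      linear_combination gbinom (α + 1) (m : ℤ) * hrec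
    rw [hstep, ih, pow_succ]
    field_simp

lemma abs_gbinom_le (z : ℝ) (m : ℕ) : |gbinom z (m : ℤ)| ≤ (|z| + 1) ^ m := by
  induction m with
  | zero => rw [gbinom_zero]; simp
  | succ m ih =>
    have hm : (0 : ℝ) < m + 1 := by positivity
    rw [gbinom_succ, mul_div_assoc, abs_mul, pow_succ]
    gcongr
    rw [abs_div, abs_of_pos hm, div_le_iff₀ hm]
    have h := abs_sub z m
    rw [Nat.abs_cast] at h
    nlinarith [mul_nonneg (abs_nonneg z) (Nat.cast_nonneg (α := ℝ) m)]

lemma summable_gbinom_mul_pow_div_factorial (z y : ℝ) :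
    Summable fun m : ℕ => |gbinom z (m : ℤ)| * |y| ^ (m + 1) / (Nat.factorial m : ℝ) := by
  refine Summable.of_nonneg_of_le (fun _ => by positivity) (fun m => ?_)
    ((Real.summable_pow_div_factorial ((|z| + 1) * |y|)).mul_left |y|)
  calc _ ≤ (|z| + 1) ^ m * |y| ^ (m + 1) / (Nat.factorial m : ℝ) := by
        gcongr; exact abs_gbinom_le z m
    _ = _ := by rw [mul_pow]; ring

/-- `a_{i+1}` as a diagonal sum of a double family. -/
lemma aFun_succ (α : ℝ) (i : ℕ) (x : ℝ) :
    aFun α (i + 1) x = ∑ p ∈ Finset.HasAntidiagonal.antidiagonal i,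
      -(gbinom (α + 1) (p.1 : ℤ) * x ^ (p.1 + 1) * gaussTerm (α + 2) p.1 p.2) := by
  have hI : Finset.Icc 1 (i + 1) = Finset.Ico (0 + 1) (i + 1 + 1) := by
    ext; simp only [Finset.mem_Icc, Finset.mem_Ico]; omega
  rw [aFun, Finset.Nat.sum_antidiagonal_eq_sum_range_succ
    (fun m r => -(gbinom (α + 1) (m : ℤ) * x ^ (m + 1) * gaussTerm (α + 2) m r)),
    Finset.mul_sum, hI, ← Finset.sum_Ico_add', ← Finset.range_eq_Ico]
  refine Finset.sum_congr rfl fun m hm => ?_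
  obtain ⟨r, rfl⟩ := Nat.exists_eq_add_of_le (Nat.lt_succ_iff.mp (Finset.mem_range.mp hm))
  have h1 : ((m + 1 : ℕ) : ℤ) - 1 = (m : ℤ) := by push_cast; ring
  have h2 : ((m + r + 1 : ℕ) : ℤ) - ((m + 1 : ℕ) : ℤ) = (r : ℤ) := by push_cast; ring
  have h3 : m + r + 1 - (m + 1) = r := by omega
  have h4 : (-1 : ℝ) ^ (m + r + 1 + (m + 1) + 1) = -(-1) ^ r := by
    rw [show m + r + 1 + (m + 1) + 1 = 2 * (m + 1) + r + 1 by ring, pow_succ, pow_add, pow_mul]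
    norm_num
  rw [h1, h2, h3, h4, Nat.add_sub_cancel_left, gaussTerm, gaussNum,
    show α + 2 + 1 = α + 3 by ring]
  ring

/-- `∑_{i=1}^∞ a_i(α,x) = -(sin πα / π) · x/((α+2)(α+3)) · ₁F₁(1; α+4; -x)`. -/
theorem statement3 (α : ℝ) (hα : -1 < α) (x : ℝ) :
    HasSum (fun i : ℕ => aFun α (i + 1) x)
      (-(Real.sin (Real.pi * α) / Real.pi) * (x / ((α + 2) * (α + 3))) *
        ∑' k : ℕ, poch 1 k * (-x) ^ k / (poch (α + 4) k * (Nat.factorial k : ℝ))) := by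
  have hβ : 0 < α + 2 := by linarith
  set f : ℕ × ℕ → ℝ := fun p =>
    -(gbinom (α + 1) (p.1 : ℤ) * x ^ (p.1 + 1) * gaussTerm (α + 2) p.1 p.2) with hf
  have hsum : Summable f := by
    refine Summable.of_norm_bounded ((summable_gbinom_mul_pow_div_factorial (α + 1) x).mul_of_nonneg
      (summable_abs_gaussTerm_zero hβ) (fun _ => by positivity) (fun _ => abs_nonneg _)) ?_
    rintro ⟨m, r⟩
    simp only [hf, norm_neg, Real.norm_eq_abs, abs_mul, abs_pow]
    calc _ ≤ |gbinom (α + 1) (m : ℤ)| * |x| ^ (m + 1) *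
          (|gaussTerm (α + 2) 0 r| / (Nat.factorial m : ℝ)) := by
          gcongr; exact abs_gaussTerm_le _ _ _
      _ = _ := by ring
  have hval : ∑' p, f p = -(Real.sin (Real.pi * α) / Real.pi) * (x / ((α + 2) * (α + 3))) *
        ∑' k : ℕ, poch 1 k * (-x) ^ k / (poch (α + 4) k * (Nat.factorial k : ℝ)) := by
    rw [hsum.tsum_prod, ← tsum_mul_left]
    refine tsum_congr fun m => ?_
    have hp := (poch_pos (show 0 < α + 4 by linarith) m).ne'
    have hm : (Nat.factorial m : ℝ) ≠ 0 := by positivity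
    simp only [hf]
    rw [tsum_neg, tsum_mul_left, mul_right_comm, gbinom_mul_tsum_gaussTerm hα, poch_one,
      neg_pow x m]
    have := Real.pi_ne_zero
    have : α + 3 ≠ 0 := by linarith
    field_simp
    ring
  rw [← hval]
  have h := (Finset.HasAntidiagonal.sigmaAntidiagonalEquivProd.hasSum_iff (f := f)).mpr hsum.hasSum
  convert h.sigma fun i => hasSum_fintype _ using 1
  ext i
  rw [aFun_succ, Finset.univ_eq_attach]
  exact (Finset.sum_attach _ f).symm
end

section
/- If α is a nonnegative integer, then for every real x, Σ_{i=1}^∞ i·a_i(α,x) = (−1)^{α+1}·x. -/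
open Finset

theorem gbinom_natCast (n k : ℕ) : gbinom (n : ℝ) (k : ℤ) = (n.choose k : ℝ) := by
  rw [gbinom, if_pos (Int.natCast_nonneg k), Int.toNat_natCast,
    ← descPochhammer_eval_eq_prod_range, Nat.cast_choose_eq_descPochhammer_div]

theorem poch_natCast (n k : ℕ) : poch (n : ℝ) k = (n.ascFactorial k : ℝ) := by
  induction k with
  | zero => simp [poch]
  | succ k ih =>
    rw [poch, Finset.prod_range_succ, ← poch, ih, Nat.ascFactorial_succ]
    push_cast
    ring

/-- The alternating sum `∑_q (-1)^q C(N,q) (N+q)! / (p+q)!` is, up to sign, the `N`-th difference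
of a monic polynomial of degree `N - p`. -/
theorem sum_alternating_choose_mul_factorial_div {N p : ℕ} (hp : p ≤ N) :
    ∑ q ∈ range (N + 1), (-1 : ℝ) ^ q * N.choose q * ((N + q).factorial / (p + q).factorial) =
      if p = 0 then (-1 : ℝ) ^ N * N.factorial else 0 := by
  have hfwd : (fwdDiff (1 : ℝ))^[N] (ascPochhammer ℝ (N - p)).eval ((p : ℝ) + 1) =
      if p = 0 then (N.factorial : ℝ) else 0 := by
    split_ifs with h
    · subst h
      have hdeg := Polynomial.fwdDiff_iter_degree_eq_factorial (ascPochhammer ℝ N)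
      rw [ascPochhammer_natDegree, (monic_ascPochhammer ℝ N).leadingCoeff] at hdeg
      simp [hdeg]
    · rw [Polynomial.fwdDiff_iter_eq_zero_of_degree_lt, Pi.zero_apply]
      rw [ascPochhammer_natDegree]
      omega
  have hsum : ∑ q ∈ range (N + 1),
      (-1 : ℝ) ^ q * N.choose q * ((N + q).factorial / (p + q).factorial) =
      (-1 : ℝ) ^ N * (fwdDiff (1 : ℝ))^[N] (ascPochhammer ℝ (N - p)).eval ((p : ℝ) + 1) := by
    rw [fwdDiff_iter_eq_sum_shift, Finset.mul_sum]
    refine Finset.sum_congr rfl fun q hq => ?_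
    have hqN : q ≤ N := Nat.lt_succ_iff.mp (Finset.mem_range.mp hq)
    have heval : (ascPochhammer ℝ (N - p)).eval ((p : ℝ) + 1 + q • (1 : ℝ)) =
        (N + q).factorial / (p + q).factorial := by
      have hfac := Nat.factorial_mul_ascFactorial (p + q) (N - p)
      rw [show p + q + (N - p) = N + q by omega] at hfac
      rw [eq_div_iff (by positivity), ← hfac, Nat.cast_mul, Nat.cast_ascFactorial, mul_comm]
      congr 2
      push_cast
      simp only [nsmul_eq_mul, mul_one]
      ring
    have hsign : (-1 : ℝ) ^ N * (-1) ^ (N - q) = (-1) ^ q := by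
      obtain ⟨r, rfl⟩ := Nat.exists_eq_add_of_le hqN
      rw [Nat.add_sub_cancel_left, pow_add, mul_assoc, ← mul_pow]
      simp
    rw [heval, zsmul_eq_mul, ← hsign]
    push_cast
    ring
  rw [hsum, hfwd, mul_ite, mul_zero]

/-- The contribution of the indices `j = p + 1`, `i = p + q + 1` to `∑ i * a_i(n, x)`. -/
noncomputable def aTerm (n : ℕ) (x : ℝ) (p q : ℕ) : ℝ :=
  (-1 : ℝ) ^ (q + 1) / (p + q).factorial * (n + 1).choose p * (n + 2).choose q *
    (n + 3).ascFactorial q * x ^ (p + 1)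

theorem succ_mul_aFun_succ (n : ℕ) (x : ℝ) (i : ℕ) :
    ((i : ℝ) + 1) * aFun (n : ℝ) (i + 1) x = ∑ p ∈ range (i + 1), aTerm n x p (i - p) := by
  have hIcc : Finset.Icc 1 (i + 1) = Finset.Ico (0 + 1) (i + 1 + 1) := by
    ext; simp
  rw [aFun, hIcc, ← Finset.sum_Ico_add' _ 0 (i + 1) 1, ← Finset.range_eq_Ico, ← mul_assoc,
    Finset.mul_sum]
  refine Finset.sum_congr rfl fun p hp => ?_
  obtain ⟨q, rfl⟩ := Nat.exists_eq_add_of_le (Nat.lt_succ_iff.mp (Finset.mem_range.mp hp))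
  have h₁ : gbinom ((n : ℝ) + 1) (((p + 1 : ℕ) : ℤ) - 1) = (n + 1).choose p := by
    rw [← gbinom_natCast]; push_cast; simp
  have h₂ : gbinom ((n : ℝ) + 2) (((p + q + 1 : ℕ) : ℤ) - ((p + 1 : ℕ) : ℤ)) =
      (n + 2).choose q := by
    rw [← gbinom_natCast]; push_cast; congr 1; ring
  have h₃ : poch ((n : ℝ) + 3) (p + q + 1 - (p + 1)) = (n + 3).ascFactorial q := by
    rw [← poch_natCast, show p + q + 1 - (p + 1) = q by omega]; push_cast; rfl
  have hsign : (-1 : ℝ) ^ (p + q + 1 + (p + 1) + 1) = (-1) ^ (q + 1) := by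
    rw [show p + q + 1 + (p + 1) + 1 = 2 * (p + 1) + (q + 1) by ring, pow_add, pow_mul]
    simp
  rw [h₁, h₂, h₃, hsign, aTerm, Nat.add_sub_cancel_left, Nat.factorial_succ]
  push_cast
  have hne : (p : ℝ) + q + 1 ≠ 0 := by positivity
  field_simp

theorem aTerm_eq_zero_of_left_lt {n p : ℕ} (hp : n + 1 < p) (x : ℝ) (q : ℕ) :
    aTerm n x p q = 0 := by
  simp [aTerm, Nat.choose_eq_zero_of_lt hp]

theorem aTerm_eq_zero_of_right_lt {n q : ℕ} (hq : n + 2 < q) (x : ℝ) (p : ℕ) :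
    aTerm n x p q = 0 := by
  simp [aTerm, Nat.choose_eq_zero_of_lt hq]

theorem sum_aTerm {n p K : ℕ} (hp : p ≤ n + 1) (hK : n + 3 ≤ K) (x : ℝ) :
    ∑ q ∈ range K, aTerm n x p q = if p = 0 then (-1 : ℝ) ^ (n + 1) * x else 0 := by
  rw [← Finset.sum_subset (Finset.range_subset_range.mpr hK) fun q _ hq =>
    aTerm_eq_zero_of_right_lt (by rw [Finset.mem_range] at hq; omega) x p]
  have hterm : ∀ q, aTerm n x p q =
      -((n + 1).choose p * x ^ (p + 1) / (n + 2).factorial) *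
        ((-1 : ℝ) ^ q * (n + 2).choose q * ((n + 2 + q).factorial / (p + q).factorial)) := by
    intro q
    rw [aTerm, ← Nat.factorial_mul_ascFactorial (n + 2) q]
    push_cast
    field_simp
    ring
  simp_rw [hterm]
  rw [← Finset.mul_sum, sum_alternating_choose_mul_factorial_div (by omega)]
  split_ifs with h
  · subst h
    simp only [Nat.choose_zero_right, Nat.cast_one]
    field_simp
    ring
  · rw [mul_zero]

/-- For nonnegative integer `α`: `∑_{i=1}^∞ i · a_i(α,x) = (-1)^{α+1} x`. -/
theorem statement6 (α : ℕ) (x : ℝ) :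
    ∑' i : ℕ, ((i : ℝ) + 1) * aFun (α : ℝ) (i + 1) x = (-1 : ℝ) ^ (α + 1) * x := by
  simp_rw [succ_mul_aFun_succ]
  rw [tsum_eq_sum (s := range (2 * α + 4))]
  · rw [Finset.sum_range_diag_flip, Finset.sum_eq_single_of_mem 0 (by simp)]
    · rw [sum_aTerm (by omega) (by omega), if_pos rfl]
    · intro p _ hp
      rcases le_or_gt p (α + 1) with h | h
      · rw [sum_aTerm h (by omega), if_neg hp]
      · exact Finset.sum_eq_zero fun q _ => aTerm_eq_zero_of_left_lt h x q
  · intro i hi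
    rw [Finset.mem_range] at hi
    refine Finset.sum_eq_zero fun p _ => ?_
    rcases le_or_gt p (α + 1) with h | h
    · exact aTerm_eq_zero_of_right_lt (by omega) x p
    · exact aTerm_eq_zero_of_left_lt h x _
end
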